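/- arXiv:2312.01533 — 4 statements merged into one kernel-verified Lean document; each statement's English description precedes it below -/
import Mathlib

section
/- For every integer n ≥ 1 and all g, h ∈ Γ, ‖ρ_n(gh) − ρ_n(g)ρ_n(h)‖_op ≤ 2π·|β(g)α(h)|/n; in particular, for every fixed g, h ∈ Γ, ‖ρ_n(gh) − ρ_n(g)ρ_n(h)‖_op → 0 as n → ∞, so (ρ_n) is an asymptotic homomorphism in the operator norm. -/
open Filter

/-- `ω_n = exp(2πi/n)`. -/
noncomputable def voiOmega (n : ℕ) : ℂ :=
  Complex.exp (2 * Real.pi * Complex.I / n)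

/-- The `n × n` Voiculescu cyclic-shift unitary `u_n`, whose `(i,j)` entry is `1`
when `i ≡ j + 1 (mod n)` and `0` otherwise. -/
noncomputable def voiU (n : ℕ) : Matrix (Fin n) (Fin n) ℂ :=
  Matrix.of fun i j => if (i : ℕ) = ((j : ℕ) + 1) % n then 1 else 0

/-- The `n × n` Voiculescu diagonal unitary `v_n`, whose `j`-th diagonal entry is
`ω_n ^ j` for `j = 1, …, n`. -/
noncomputable def voiV (n : ℕ) : Matrix (Fin n) (Fin n) ℂ :=
  Matrix.diagonal fun j => voiOmega n ^ ((j : ℕ) + 1)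

/-- Given homomorphisms `α, β : Γ → ℤ`, the map `ρ_n(g) = u_n ^ α(g) * v_n ^ β(g)`. -/
noncomputable def voiRho {Γ : Type*} [Group Γ] (α β : Γ → ℤ) (n : ℕ) (g : Γ) :
    Matrix (Fin n) (Fin n) ℂ :=
  voiU n ^ α g * voiV n ^ β g

/-- The operator norm of an `n × n` complex matrix acting on the ℓ² space `ℂ^n`. -/
noncomputable def l2OpNorm {n : ℕ} (M : Matrix (Fin n) (Fin n) ℂ) : ℝ :=
  ‖LinearMap.toContinuousLinearMap (Matrix.toEuclideanLin M)‖

open scoped Matrix.Norms.L2Operator in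
/-- `l2OpNorm` is Mathlib's `L²` operator norm on matrices. -/
theorem l2OpNorm_eq_norm {n : ℕ} (M : Matrix (Fin n) (Fin n) ℂ) : l2OpNorm M = ‖M‖ := rfl

theorem zpow_mul_zpow_of_mul_eq {G : Type*} [Group G] {u v z : G} (hz : ∀ g, Commute z g)
    (h : v * u = z * u * v) (a b : ℤ) : v ^ b * u ^ a = z ^ (b * a) * (u ^ a * v ^ b) := by
  have h₁ : v * u ^ a = z ^ a * u ^ a * v := by
    rw [← (hz u).mul_zpow]
    exact (show SemiconjBy v u (z * u) from h).zpow_right a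
  have h₂ : SemiconjBy (u ^ a) (z ^ a * v) v := by
    rw [SemiconjBy, h₁, ← mul_assoc, ((hz (u ^ a)).zpow_left a).eq]
  have h₃ := h₂.zpow_right b
  rw [((hz v).zpow_left a).mul_zpow, ← zpow_mul, mul_comm a b] at h₃
  rw [← h₃.eq, ← mul_assoc, ← mul_assoc, ((hz (u ^ a)).zpow_left (b * a)).eq]

theorem Matrix.unitaryGroup_coe_zpow {m : Type*} [Fintype m] [DecidableEq m]
    (U : Matrix.unitaryGroup m ℂ) (k : ℤ) :
    ((U ^ k : Matrix.unitaryGroup m ℂ) : Matrix m m ℂ) = (U : Matrix m m ℂ) ^ k := by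
  have h := Matrix.coe_units_zpow (Unitary.toUnits U) k
  rwa [← map_zpow] at h

theorem voiOmega_pow_self {n : ℕ} (hn : n ≠ 0) : voiOmega n ^ n = 1 := by
  have hn' : (n : ℂ) ≠ 0 := Nat.cast_ne_zero.mpr hn
  rw [voiOmega, ← Complex.exp_nat_mul, mul_div_cancel₀ _ hn', Complex.exp_two_pi_mul_I]

theorem voiOmega_zpow (n : ℕ) (k : ℤ) :
    voiOmega n ^ k = Complex.exp (Complex.I * ((2 * Real.pi * k / n : ℝ) : ℂ)) := by
  rw [voiOmega, ← Complex.exp_int_mul]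
  congr 1
  push_cast
  ring

theorem norm_voiOmega (n : ℕ) : ‖voiOmega n‖ = 1 := by
  have h := voiOmega_zpow n 1
  rw [zpow_one] at h
  rw [h, mul_comm, Complex.norm_exp_ofReal_mul_I]

theorem voiOmega_mem_unitary (n : ℕ) : voiOmega n ∈ unitary ℂ := by
  have h : voiOmega n * star (voiOmega n) = 1 := by
    simp [Complex.mul_conj, Complex.normSq_eq_norm_sq, norm_voiOmega]
  exact Unitary.mem_iff.mpr ⟨by rw [mul_comm, h], h⟩

theorem norm_one_sub_voiOmega_zpow_le (n : ℕ) (k : ℤ) :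
    ‖1 - voiOmega n ^ k‖ ≤ 2 * Real.pi * |(k : ℝ)| / n := by
  rw [voiOmega_zpow, norm_sub_rev]
  refine (Real.norm_exp_I_mul_ofReal_sub_one_le).trans_eq ?_
  rw [Real.norm_eq_abs, abs_div, abs_mul, abs_of_pos Real.two_pi_pos, Nat.abs_cast]

theorem voiU_mem_unitaryGroup {n : ℕ} (hn : n ≠ 0) : voiU n ∈ Matrix.unitaryGroup (Fin n) ℂ := by
  have : NeZero n := ⟨hn⟩
  have hU : voiU n = Matrix.of fun i j : Fin n => if i = j + 1 then (1 : ℂ) else 0 := by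
    ext i j
    simp [voiU, Fin.ext_iff, Fin.val_add, Nat.add_mod]
  rw [Matrix.mem_unitaryGroup_iff', hU]
  ext i j
  simp [Matrix.mul_apply, Matrix.star_apply, Matrix.one_apply, eq_comm]

theorem voiV_mem_unitaryGroup (n : ℕ) : voiV n ∈ Matrix.unitaryGroup (Fin n) ℂ := by
  rw [Matrix.mem_unitaryGroup_iff', voiV, Matrix.star_eq_conjTranspose,
    Matrix.diagonal_conjTranspose, Matrix.diagonal_mul_diagonal, Matrix.diagonal_eq_one]
  funext j
  exact Unitary.star_mul_self_of_mem (pow_mem (voiOmega_mem_unitary n) _)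

theorem voiV_mul_voiU {n : ℕ} (hn : n ≠ 0) :
    voiV n * voiU n = voiOmega n • (voiU n * voiV n) := by
  ext i j
  rw [Matrix.smul_apply, voiV, Matrix.diagonal_mul, Matrix.mul_diagonal, voiU, Matrix.of_apply]
  split_ifs with h
  · rw [h, pow_succ, ← pow_eq_pow_mod _ (voiOmega_pow_self hn), smul_eq_mul]
    ring
  · simp

theorem voiV_zpow_mul_voiU_zpow {n : ℕ} (hn : n ≠ 0) (a b : ℤ) :
    voiV n ^ b * voiU n ^ a = voiOmega n ^ (b * a) • (voiU n ^ a * voiV n ^ b) := by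
  let U : (Matrix (Fin n) (Fin n) ℂ)ˣ := Unitary.toUnits ⟨voiU n, voiU_mem_unitaryGroup hn⟩
  let V : (Matrix (Fin n) (Fin n) ℂ)ˣ := Unitary.toUnits ⟨voiV n, voiV_mem_unitaryGroup n⟩
  let ω : ℂˣ := Unitary.toUnits ⟨voiOmega n, voiOmega_mem_unitary n⟩
  let Z : (Matrix (Fin n) (Fin n) ℂ)ˣ := Units.map (algebraMap ℂ _).toMonoidHom ω
  have hZ (M : (Matrix (Fin n) (Fin n) ℂ)ˣ) : Commute Z M := Units.ext (
    Algebra.commutes (voiOmega n) (M : Matrix (Fin n) (Fin n) ℂ))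
  have hVU : V * U = Z * U * V := Units.ext <| by
    refine (voiV_mul_voiU hn).trans ?_
    rw [Algebra.smul_def, ← mul_assoc]
    rfl
  have hZpow (k : ℤ) : ((Z ^ k : (Matrix (Fin n) (Fin n) ℂ)ˣ) : Matrix (Fin n) (Fin n) ℂ) =
      algebraMap ℂ _ (voiOmega n ^ k) := by
    rw [← map_zpow]
    exact congrArg (algebraMap ℂ _) (Units.val_zpow_eq_zpow_val ω k)
  have h := congrArg Units.val (zpow_mul_zpow_of_mul_eq hZ hVU a b)
  simp only [Units.val_mul, hZpow, Matrix.coe_units_zpow] at h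
  rwa [← Algebra.smul_def] at h

open scoped Matrix.Norms.L2Operator in
theorem l2OpNorm_voiRho_defect_le {Γ : Type*} [Group Γ] (α β : Γ → ℤ)
    (hα : ∀ g h : Γ, α (g * h) = α g + α h) (hβ : ∀ g h : Γ, β (g * h) = β g + β h)
    {n : ℕ} (hn : n ≠ 0) (g h : Γ) :
    l2OpNorm (voiRho α β n (g * h) - voiRho α β n g * voiRho α β n h) ≤
      2 * Real.pi * |(β g * α h : ℝ)| / n := by
  set U : Matrix.unitaryGroup (Fin n) ℂ := ⟨voiU n, voiU_mem_unitaryGroup hn⟩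
  set V : Matrix.unitaryGroup (Fin n) ℂ := ⟨voiV n, voiV_mem_unitaryGroup n⟩
  have hU (k : ℤ) : voiU n ^ k = (U ^ k : Matrix.unitaryGroup (Fin n) ℂ) :=
    (Matrix.unitaryGroup_coe_zpow U k).symm
  have hV (k : ℤ) : voiV n ^ k = (V ^ k : Matrix.unitaryGroup (Fin n) ℂ) :=
    (Matrix.unitaryGroup_coe_zpow V k).symm
  have hleft : voiRho α β n (g * h) =
      voiU n ^ α g * (voiU n ^ α h * voiV n ^ β g) * voiV n ^ β h := by
    rw [voiRho, hα, hβ, hU, hV, zpow_add, zpow_add, hU, hU, hV, hV]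
    simp [mul_assoc]
  have hright : voiRho α β n g * voiRho α β n h = voiOmega n ^ (β g * α h) •
      (voiU n ^ α g * (voiU n ^ α h * voiV n ^ β g) * voiV n ^ β h) := by
    rw [← Matrix.smul_mul, ← Matrix.mul_smul, ← voiV_zpow_mul_voiU_zpow hn]
    simp only [voiRho, mul_assoc]
  have hunitary : voiU n ^ α g * (voiU n ^ α h * voiV n ^ β g) * voiV n ^ β h ∈
      unitary (Matrix (Fin n) (Fin n) ℂ) := by
    rw [hU, hU, hV, hV]
    exact (U ^ α g * (U ^ α h * V ^ β g) * V ^ β h).2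
  have : NeZero n := ⟨hn⟩
  have hdefect : voiRho α β n (g * h) - voiRho α β n g * voiRho α β n h =
      (1 - voiOmega n ^ (β g * α h)) •
        (voiU n ^ α g * (voiU n ^ α h * voiV n ^ β g) * voiV n ^ β h) := by
    rw [hright, hleft, sub_smul, one_smul]
  rw [l2OpNorm_eq_norm, hdefect, norm_smul, CStarRing.norm_of_mem_unitary hunitary, mul_one]
  exact_mod_cast norm_one_sub_voiOmega_zpow_le n (β g * α h)

/-- For every `n ≥ 1` and `g, h ∈ Γ`,
`‖ρ_n(gh) − ρ_n(g)ρ_n(h)‖_op ≤ 2π|β(g)α(h)|/n`; in particular, for every fixed `g, h`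
the defect tends to `0` in operator norm as `n → ∞`, so `(ρ_n)` is an asymptotic
homomorphism in the operator norm. -/
theorem voiRho_asymptotic_hom_opNorm {Γ : Type*} [Group Γ] (α β : Γ → ℤ)
    (hα : ∀ g h : Γ, α (g * h) = α g + α h) (hβ : ∀ g h : Γ, β (g * h) = β g + β h) :
    (∀ n : ℕ, 1 ≤ n → ∀ g h : Γ,
        l2OpNorm (voiRho α β n (g * h) - voiRho α β n g * voiRho α β n h) ≤
          2 * Real.pi * |(β g * α h : ℝ)| / n) ∧
      ∀ g h : Γ,
        Tendsto (fun n : ℕ => l2OpNorm (voiRho α β n (g * h) - voiRho α β n g * voiRho α β n h))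
          atTop (nhds 0) := by
  have hbound := fun n (hn : 1 ≤ n) => l2OpNorm_voiRho_defect_le α β hα hβ
    (Nat.one_le_iff_ne_zero.mp hn)
  refine ⟨hbound, fun g h => ?_⟩
  refine squeeze_zero' (Eventually.of_forall fun n => norm_nonneg _)
    ((eventually_ge_atTop 1).mono fun n hn => hbound n hn g h) ?_
  exact tendsto_const_div_atTop_nhds_zero_nat _
end

section
/- Let Γ be a group and α, β : Γ → ℤ group homomorphisms, and suppose there is a 2-cycle (N; x_1,…,x_N; a_1,…,a_N; b_1,…,b_N) on Γ with Σ_{j=1}^N x_j·α(a_j)β(b_j) ≠ 0. Then Γ is not Frobenius stable: there exists a sequence of maps φ_n : Γ → U(n) into the n×n complex unitary matrices with ‖φ_n(gh) − φ_n(g)φ_n(h)‖_F → 0 as n → ∞ for all g, h ∈ Γ, such that no sequence of group homomorphisms ψ_n : Γ → U(n) satisfies ‖ψ_n(g) − φ_n(g)‖_F → 0 for all g ∈ Γ. -/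
open Filter

/-- The data `(x_j, a_j, b_j)_{j=1}^N` is a 2-cycle on `Γ` when
`Σ_j x_j([a_j] − [a_j b_j] + [b_j]) = 0` in the free abelian group `ℤ[Γ]`. -/
def IsTwoCycle {Γ : Type*} [Group Γ] {N : ℕ} (x : Fin N → ℤ) (a b : Fin N → Γ) : Prop :=
  ∑ j : Fin N,
    (Finsupp.single (a j) (x j) - Finsupp.single (a j * b j) (x j)
      + Finsupp.single (b j) (x j)) = (0 : Γ →₀ ℤ)

/-- The unnormalized Frobenius (Hilbert–Schmidt) norm `‖M‖_F = (Σ_{i,j} |M_{ij}|²)^{1/2}`. -/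
noncomputable def frobNorm {n : ℕ} (M : Matrix (Fin n) (Fin n) ℂ) : ℝ :=
  Real.sqrt (∑ i, ∑ j, ‖M i j‖ ^ 2)

section Frobenius

variable {n : ℕ}

theorem frobNorm_eq_sqrt_trace (M : Matrix (Fin n) (Fin n) ℂ) :
    frobNorm M = Real.sqrt (Matrix.trace (M * star M)).re := by
  simp only [frobNorm, Matrix.trace, Matrix.diag_apply, Matrix.mul_apply, Matrix.star_apply,
    Complex.re_sum, Complex.star_def, Complex.mul_conj, Complex.ofReal_re,
    Complex.normSq_eq_norm_sq]

theorem frobNorm_mul_unitary (M : Matrix (Fin n) (Fin n) ℂ)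
    (U : Matrix.unitaryGroup (Fin n) ℂ) :
    frobNorm (M * (U : Matrix (Fin n) (Fin n) ℂ)) = frobNorm M := by
  rw [frobNorm_eq_sqrt_trace, frobNorm_eq_sqrt_trace, star_mul, Matrix.mul_assoc,
    ← Matrix.mul_assoc (U : Matrix (Fin n) (Fin n) ℂ), Matrix.mem_unitaryGroup_iff.mp U.2,
    Matrix.one_mul]

theorem frobNorm_unitary (U : Matrix.unitaryGroup (Fin n) ℂ) :
    frobNorm (U : Matrix (Fin n) (Fin n) ℂ) = Real.sqrt n := by
  rw [frobNorm_eq_sqrt_trace, Matrix.mem_unitaryGroup_iff.mp U.2, Matrix.trace_one]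
  simp

theorem frobNorm_smul (c : ℂ) (M : Matrix (Fin n) (Fin n) ℂ) :
    frobNorm (c • M) = ‖c‖ * frobNorm M := by
  simp only [frobNorm, Matrix.smul_apply, smul_eq_mul, norm_mul, mul_pow, ← Finset.mul_sum]
  rw [Real.sqrt_mul (by positivity), Real.sqrt_sq (norm_nonneg c)]

theorem norm_trace_mul_le (A B : Matrix (Fin n) (Fin n) ℂ) :
    ‖Matrix.trace (A * B)‖ ≤ frobNorm A * frobNorm B := by
  have hB : frobNorm B = Real.sqrt (∑ p : Fin n × Fin n, ‖B p.2 p.1‖ ^ 2) := by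
    rw [frobNorm, Fintype.sum_prod_type, Finset.sum_comm]
  rw [hB, frobNorm, ← Fintype.sum_prod_type' fun i j => ‖A i j‖ ^ 2]
  refine le_trans ?_ (Real.sum_mul_le_sqrt_mul_sqrt _ _ _)
  simp only [Matrix.trace, Matrix.diag_apply, Matrix.mul_apply]
  rw [← Fintype.sum_prod_type' fun i j => A i j * B j i]
  exact (norm_sum_le _ _).trans_eq (by simp only [norm_mul])

/-- The first-order term of `Tr log (P A*)` for `P` close to the unitary `A`. -/
noncomputable def traceDefect (P : Matrix (Fin n) (Fin n) ℂ)
    (A : Matrix.unitaryGroup (Fin n) ℂ) : ℂ :=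
  Matrix.trace ((P - (A : Matrix (Fin n) (Fin n) ℂ)) * star (A : Matrix (Fin n) (Fin n) ℂ))

theorem norm_traceDefect_le (P : Matrix (Fin n) (Fin n) ℂ)
    (A : Matrix.unitaryGroup (Fin n) ℂ) :
    ‖traceDefect P A‖ ≤ frobNorm (P - (A : Matrix (Fin n) (Fin n) ℂ)) * Real.sqrt n := by
  refine (norm_trace_mul_le _ _).trans_eq ?_
  rw [← Unitary.coe_star, frobNorm_unitary]

/-- The second-order remainder in the multiplicativity of `traceDefect`. -/
noncomputable def traceRemainder (P Q : Matrix (Fin n) (Fin n) ℂ)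
    (A B : Matrix.unitaryGroup (Fin n) ℂ) : ℂ :=
  Matrix.trace ((P - (A : Matrix (Fin n) (Fin n) ℂ)) *
    ((Q - (B : Matrix (Fin n) (Fin n) ℂ)) *
      ((star B * star A : Matrix.unitaryGroup (Fin n) ℂ) : Matrix (Fin n) (Fin n) ℂ)))

theorem norm_traceRemainder_le (P Q : Matrix (Fin n) (Fin n) ℂ)
    (A B : Matrix.unitaryGroup (Fin n) ℂ) :
    ‖traceRemainder P Q A B‖ ≤
      frobNorm (P - (A : Matrix (Fin n) (Fin n) ℂ)) * frobNorm (Q - (B : Matrix (Fin n) (Fin n) ℂ)) := by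
  refine (norm_trace_mul_le _ _).trans_eq ?_
  rw [frobNorm_mul_unitary]

theorem traceDefect_mul (P Q : Matrix (Fin n) (Fin n) ℂ)
    (A B C : Matrix.unitaryGroup (Fin n) ℂ) (w : Circle)
    (h : (A : Matrix (Fin n) (Fin n) ℂ) * B = (w : ℂ) • (C : Matrix (Fin n) (Fin n) ℂ)) :
    traceDefect (P * Q) C - traceDefect P A - traceDefect Q B =
      ((w : ℂ) - 1) * n + ((w : ℂ) - 1) * traceDefect P A + ((w : ℂ) - 1) * traceDefect Q B
        + w * traceRemainder P Q A B := by
  have hA := Matrix.mem_unitaryGroup_iff.mp A.2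
  have hA' := Matrix.mem_unitaryGroup_iff'.mp A.2
  have hB := Matrix.mem_unitaryGroup_iff.mp B.2
  have hC := Matrix.mem_unitaryGroup_iff.mp C.2
  have hw : (w : ℂ) * star (w : ℂ) = 1 := by
    rw [Complex.star_def, Complex.mul_conj]; simp
  unfold traceDefect traceRemainder
  simp only [Submonoid.coe_mul, Unitary.coe_star] at *
  generalize (A : Matrix (Fin n) (Fin n) ℂ) = A at *
  generalize (B : Matrix (Fin n) (Fin n) ℂ) = B at *
  generalize (C : Matrix (Fin n) (Fin n) ℂ) = C at *
  have hC' : star C = (w : ℂ) • (star B * star A) := by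
    rw [← star_mul, h, star_smul, smul_smul, hw, one_smul]
  have hQ : Matrix.trace (A * (Q * (star B * star A))) = Matrix.trace (Q * star B) := by
    rw [← Matrix.mul_assoc Q, Matrix.trace_mul_comm, Matrix.mul_assoc, hA', Matrix.mul_one]
  have hP : B * (star B * star A) = star A := by
    rw [← Matrix.mul_assoc, hB, Matrix.one_mul]
  have hn : Matrix.trace (1 : Matrix (Fin n) (Fin n) ℂ) = n := by simp
  simp only [sub_mul, mul_sub, Matrix.trace_sub, hA, hB, hC, hn, hP, Matrix.mul_assoc, hQ]
  rw [hC', mul_smul_comm, mul_smul_comm, Matrix.trace_smul, smul_eq_mul]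
  ring

end Frobenius

section ClockShift

variable (n : ℕ)

/-- Diagonal matrices with entries on the unit circle, as unitaries. -/
noncomputable def diagonalUnitary : (Fin n → Circle) →* Matrix.unitaryGroup (Fin n) ℂ where
  toFun d := ⟨Matrix.diagonal fun i => (d i : ℂ), by
    rw [Matrix.mem_unitaryGroup_iff, Matrix.star_eq_conjTranspose,
      Matrix.diagonal_conjTranspose, Matrix.diagonal_mul_diagonal, ← Matrix.diagonal_one]
    congr 1
    ext i
    simp [Complex.mul_conj]⟩
  map_one' := Subtype.ext (by simp)
  map_mul' d e := Subtype.ext (by simp [Matrix.diagonal_mul_diagonal])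

theorem coe_diagonalUnitary_const (w : Circle) :
    (diagonalUnitary n (fun _ => w) : Matrix (Fin n) (Fin n) ℂ) = (w : ℂ) • 1 := by
  rw [Matrix.smul_one_eq_diagonal]
  rfl

/-- The standard primitive `n`-th root of unity. -/
noncomputable def clockRoot : Circle := Circle.exp (2 * Real.pi / n)

theorem clockRoot_pow_self : clockRoot n ^ n = 1 := by
  rcases eq_or_ne n 0 with rfl | hn
  · simp
  · rw [clockRoot, ← Circle.exp_natCast_mul, mul_div_cancel₀ _ (Nat.cast_ne_zero.mpr hn),
      Circle.exp_two_pi]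

/-- The clock matrix. -/
noncomputable def clock : Matrix.unitaryGroup (Fin n) ℂ :=
  diagonalUnitary n fun i => clockRoot n ^ (i : ℕ)

/-- The cyclic shift matrix. -/
noncomputable def shift : Matrix.unitaryGroup (Fin n) ℂ :=
  ⟨(finRotate n).permMatrix ℂ, by
    rw [Matrix.mem_unitaryGroup_iff, Matrix.star_eq_conjTranspose,
      Matrix.conjTranspose_permMatrix, ← Matrix.permMatrix_mul, inv_mul_cancel,
      Matrix.permMatrix_one]⟩

theorem shift_mul_clock :
    shift n * clock n = diagonalUnitary n (fun _ => clockRoot n) * (clock n * shift n) := by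
  have key (i : Fin n) : (clockRoot n) ^ (finRotate n i : ℕ) = clockRoot n ^ ((i : ℕ) + 1) := by
    cases n with
    | zero => exact i.elim0
    | succ n =>
      rw [coe_finRotate]
      split_ifs with h
      · subst h
        rw [Fin.val_last, clockRoot_pow_self, pow_zero]
      · rfl
  refine Subtype.ext (Matrix.ext fun i j => ?_)
  rw [Submonoid.coe_mul, Submonoid.coe_mul, Submonoid.coe_mul, coe_diagonalUnitary_const,
    smul_mul_assoc, Matrix.one_mul, Matrix.smul_apply]
  change ((finRotate n).permMatrix ℂ * Matrix.diagonal _ : Matrix (Fin n) (Fin n) ℂ) i j =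
    _ • (Matrix.diagonal _ * (finRotate n).permMatrix ℂ : Matrix (Fin n) (Fin n) ℂ) i j
  rw [Matrix.mul_diagonal, Matrix.diagonal_mul, Equiv.Perm.permMatrix, PEquiv.toMatrix_apply]
  by_cases h : finRotate n i = j
  · subst h
    simp only [Equiv.toPEquiv_apply, Option.mem_some_iff, if_true, one_mul, mul_one, key,
      smul_eq_mul, ← Circle.coe_mul, pow_succ']
  · simp [h, -finRotate_apply]

theorem shift_zpow_mul_clock_zpow (a b : ℤ) :
    shift n ^ a * clock n ^ b =
      diagonalUnitary n (fun _ => clockRoot n ^ (a * b)) * (clock n ^ b * shift n ^ a) := by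
  set z := diagonalUnitary n (fun _ => clockRoot n) with hz
  have hcomm (U : Matrix.unitaryGroup (Fin n) ℂ) : Commute z U := by
    refine Subtype.ext ?_
    rw [Submonoid.coe_mul, Submonoid.coe_mul, hz, coe_diagonalUnitary_const]
    simp
  have h₁ : SemiconjBy (shift n) (clock n ^ b) (z ^ b * clock n ^ b) := by
    rw [← (hcomm _).mul_zpow]
    refine SemiconjBy.zpow_right ?_ b
    rw [SemiconjBy, shift_mul_clock, mul_assoc]
  have h₂ : SemiconjBy (clock n ^ b) (z ^ b * shift n) (shift n) := by
    rw [SemiconjBy, h₁.eq, ((hcomm (clock n ^ b)).zpow_left b).eq, mul_assoc]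
  have hz_pow : diagonalUnitary n (fun _ => clockRoot n ^ (a * b)) = (z ^ b) ^ a := by
    rw [← zpow_mul, mul_comm b a, hz, ← map_zpow]
    rfl
  have h₃ := (h₂.zpow_right a).eq
  rw [((hcomm (shift n)).zpow_left b).mul_zpow, ← mul_assoc,
    ← (((hcomm (clock n ^ b)).zpow_left b).zpow_left a).eq, mul_assoc] at h₃
  rw [hz_pow, h₃]

theorem tendsto_clockRoot_zpow_sub_one (k : ℤ) :
    Tendsto (fun n : ℕ => (((clockRoot n ^ k : Circle) : ℂ) - 1) * n) atTop
      (nhds (2 * Real.pi * Complex.I * k)) := by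
  have hd : HasDerivAt (fun t : ℝ => Complex.exp (t * (2 * Real.pi * Complex.I * k)))
      (2 * Real.pi * Complex.I * k) 0 := by
    simpa using ((Complex.ofRealCLM.hasDerivAt (x := (0 : ℝ))).mul_const
      (2 * Real.pi * Complex.I * k)).cexp
  have ht : Tendsto (fun n : ℕ => (n : ℝ)⁻¹) atTop (nhdsWithin 0 (Set.Ioi 0)) :=
    tendsto_inv_atTop_nhdsGT_zero.comp tendsto_natCast_atTop_atTop
  refine (hd.tendsto_slope_zero_right.comp ht).congr fun n => ?_
  have hw : ((clockRoot n ^ k : Circle) : ℂ) =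
      Complex.exp (((n : ℝ)⁻¹ : ℝ) * (2 * Real.pi * Complex.I * k)) := by
    rw [clockRoot, ← Circle.exp_zsmul, Circle.coe_exp]
    congr 1
    push_cast [zsmul_eq_mul]
    ring
  rw [hw]
  simp [mul_comm]

theorem tendsto_norm_clockRoot_zpow_sub_one_mul_sqrt (k : ℤ) :
    Tendsto (fun n : ℕ => ‖((clockRoot n ^ k : Circle) : ℂ) - 1‖ * Real.sqrt n) atTop
      (nhds 0) := by
  have hs : Tendsto (fun n : ℕ => (Real.sqrt n)⁻¹) atTop (nhds 0) :=
    (Real.tendsto_sqrt_atTop.comp tendsto_natCast_atTop_atTop).inv_tendsto_atTop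
  have h := (tendsto_clockRoot_zpow_sub_one k).norm.mul hs
  rw [mul_zero] at h
  refine h.congr fun n => ?_
  rw [norm_mul, Complex.norm_natCast, mul_assoc, ← div_eq_mul_inv, Real.div_sqrt]

end ClockShift

/-- The projective representation of `Γ` by clock and shift matrices with cocycle
`clockRoot n ^ (α g * β h)`. -/
noncomputable def clockShiftMap {Γ : Type*} (α β : Γ → ℤ) (n : ℕ) (g : Γ) :
    Matrix.unitaryGroup (Fin n) ℂ :=
  clock n ^ β g * shift n ^ α g

theorem clockShiftMap_mul {Γ : Type*} [Group Γ] {α β : Γ → ℤ} (n : ℕ) (g h : Γ)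
    (hα : ∀ g h : Γ, α (g * h) = α g + α h) (hβ : ∀ g h : Γ, β (g * h) = β g + β h) :
    (clockShiftMap α β n g : Matrix (Fin n) (Fin n) ℂ) * clockShiftMap α β n h =
      ((clockRoot n ^ (α g * β h) : Circle) : ℂ) •
        (clockShiftMap α β n (g * h) : Matrix (Fin n) (Fin n) ℂ) := by
  have hgroup : clockShiftMap α β n g * clockShiftMap α β n h =
      diagonalUnitary n (fun _ => clockRoot n ^ (α g * β h)) * clockShiftMap α β n (g * h) := by
    have hcomm (U : Matrix.unitaryGroup (Fin n) ℂ) :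
        Commute (diagonalUnitary n (fun _ => clockRoot n ^ (α g * β h))) U := by
      refine Subtype.ext ?_
      rw [Submonoid.coe_mul, Submonoid.coe_mul, coe_diagonalUnitary_const]
      simp
    rw [clockShiftMap, clockShiftMap, clockShiftMap, hα, hβ, zpow_add, zpow_add, mul_assoc,
      ← mul_assoc (shift n ^ α g), shift_zpow_mul_clock_zpow, ← mul_assoc, ← mul_assoc,
      ← (hcomm (clock n ^ β g)).eq]
    simp only [mul_assoc]
  rw [← Submonoid.coe_mul, hgroup, Submonoid.coe_mul, coe_diagonalUnitary_const, smul_mul_assoc,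
    Matrix.one_mul]

theorem IsTwoCycle.sum_eq_zero {Γ : Type*} [Group Γ] {N : ℕ} {x : Fin N → ℤ} {a b : Fin N → Γ}
    (h : IsTwoCycle x a b) (E : Γ → ℂ) :
    ∑ j, (x j : ℂ) * (E (a j * b j) - E (a j) - E (b j)) = 0 := by
  have h' := congrArg (Finsupp.linearCombination ℤ E) h
  simp only [map_sum, map_add, map_sub, Finsupp.linearCombination_single, map_zero,
    zsmul_eq_mul] at h'
  rw [← neg_eq_zero, ← Finset.sum_neg_distrib, ← h']
  exact Finset.sum_congr rfl fun j _ => by ring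

/-- Along a perturbation of an almost multiplicative family with scalar defect `w n`, the
`traceDefect` is asymptotically a cochain bounding `lim n (w n - 1)`. -/
theorem tendsto_traceDefect_mul {P Q : ∀ n : ℕ, Matrix (Fin n) (Fin n) ℂ}
    {A B C : ∀ n : ℕ, Matrix.unitaryGroup (Fin n) ℂ} {w : ℕ → Circle} {c : ℂ}
    (h : ∀ n, (A n : Matrix (Fin n) (Fin n) ℂ) * B n =
      (w n : ℂ) • (C n : Matrix (Fin n) (Fin n) ℂ))
    (hP : Tendsto (fun n => frobNorm (P n - (A n : Matrix (Fin n) (Fin n) ℂ))) atTop (nhds 0))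
    (hQ : Tendsto (fun n => frobNorm (Q n - (B n : Matrix (Fin n) (Fin n) ℂ))) atTop (nhds 0))
    (hw : Tendsto (fun n : ℕ => ((w n : ℂ) - 1) * n) atTop (nhds c))
    (hw' : Tendsto (fun n : ℕ => ‖(w n : ℂ) - 1‖ * Real.sqrt n) atTop (nhds 0)) :
    Tendsto (fun n => traceDefect (P n * Q n) (C n) - traceDefect (P n) (A n)
      - traceDefect (Q n) (B n)) atTop (nhds c) := by
  have hlin {R : ∀ n : ℕ, Matrix (Fin n) (Fin n) ℂ} {D : ∀ n : ℕ, Matrix.unitaryGroup (Fin n) ℂ}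
      (hR : Tendsto (fun n => frobNorm (R n - (D n : Matrix (Fin n) (Fin n) ℂ))) atTop (nhds 0)) :
      Tendsto (fun n => ((w n : ℂ) - 1) * traceDefect (R n) (D n)) atTop (nhds 0) := by
    have hm := hw'.mul hR
    rw [mul_zero] at hm
    refine squeeze_zero_norm (fun n => ?_) hm
    rw [norm_mul, mul_assoc, mul_comm (Real.sqrt n)]
    exact mul_le_mul_of_nonneg_left (norm_traceDefect_le _ _) (norm_nonneg _)
  have hquad : Tendsto (fun n => (w n : ℂ) * traceRemainder (P n) (Q n) (A n) (B n)) atTop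
      (nhds 0) := by
    have hm := hP.mul hQ
    rw [mul_zero] at hm
    refine squeeze_zero_norm (fun n => ?_) hm
    rw [norm_mul, Circle.norm_coe, one_mul]
    exact norm_traceRemainder_le _ _ _ _
  have hsum := ((hw.add (hlin hP)).add (hlin hQ)).add hquad
  simp only [add_zero] at hsum
  exact hsum.congr fun n => (traceDefect_mul _ _ _ _ _ _ (h n)).symm

/-- If `α, β : Γ → ℤ` are homomorphisms and the cocycle `(g,h) ↦ α(g)β(h)` pairs
nontrivially with some 2-cycle, then `Γ` is not Frobenius stable: there is an
asymptotic homomorphism `φ_n : Γ → U(n)` in the unnormalized Frobenius norm that is not perturbable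
to genuine representations in the unnormalized Frobenius norm. -/
theorem not_frobenius_stable {Γ : Type*} [Group Γ] (α β : Γ → ℤ)
    (hα : ∀ g h : Γ, α (g * h) = α g + α h) (hβ : ∀ g h : Γ, β (g * h) = β g + β h)
    (N : ℕ) (x : Fin N → ℤ) (a b : Fin N → Γ) (hcycle : IsTwoCycle x a b)
    (hpair : ∑ j : Fin N, x j * (α (a j) * β (b j)) ≠ 0) :
    ∃ φ : ∀ n : ℕ, Γ → Matrix.unitaryGroup (Fin n) ℂ,
      (∀ g h : Γ,
          Tendsto
            (fun n : ℕ =>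
              frobNorm ((φ n (g * h) : Matrix (Fin n) (Fin n) ℂ) -
                (φ n g : Matrix (Fin n) (Fin n) ℂ) * (φ n h : Matrix (Fin n) (Fin n) ℂ)))
            atTop (nhds 0)) ∧
        ¬ ∃ ψ : ∀ n : ℕ, Γ →* Matrix.unitaryGroup (Fin n) ℂ,
            ∀ g : Γ,
              Tendsto
                (fun n : ℕ =>
                  frobNorm ((ψ n g : Matrix (Fin n) (Fin n) ℂ) -
                    (φ n g : Matrix (Fin n) (Fin n) ℂ)))
                atTop (nhds 0) := by
  refine ⟨clockShiftMap α β, fun g h => ?_, ?_⟩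
  · refine (tendsto_norm_clockRoot_zpow_sub_one_mul_sqrt (α g * β h)).congr fun n => ?_
    rw [clockShiftMap_mul n g h hα hβ, ← frobNorm_unitary (clockShiftMap α β n (g * h)),
      norm_sub_rev, ← frobNorm_smul, sub_smul, one_smul]
  · rintro ⟨ψ, hψ⟩
    have hlim (j : Fin N) := tendsto_traceDefect_mul
      (fun n => clockShiftMap_mul n (a j) (b j) hα hβ) (hψ (a j)) (hψ (b j))
      (tendsto_clockRoot_zpow_sub_one _) (tendsto_norm_clockRoot_zpow_sub_one_mul_sqrt _)
    have hsum := tendsto_finsetSum Finset.univ fun j _ => (hlim j).const_mul (x j : ℂ)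
    have hzero : ∑ j, (x j : ℂ) * (2 * Real.pi * Complex.I * (α (a j) * β (b j) : ℤ)) = 0 := by
      refine tendsto_nhds_unique hsum (tendsto_const_nhds.congr fun n => ?_)
      rw [← hcycle.sum_eq_zero fun g =>
        traceDefect (ψ n g : Matrix (Fin n) (Fin n) ℂ) (clockShiftMap α β n g)]
      simp only [map_mul, Submonoid.coe_mul]
    apply hpair
    have hfactor : (2 * Real.pi * Complex.I : ℂ) *
        ((∑ j, x j * (α (a j) * β (b j)) : ℤ) : ℂ) = 0 := by
      rw [← hzero, Int.cast_sum, Finset.mul_sum]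
      refine Finset.sum_congr rfl fun j _ => ?_
      push_cast
      ring
    exact_mod_cast (mul_eq_zero.mp hfactor).resolve_left Complex.two_pi_I_ne_zero
end

section
/- Let Γ and Υ be groups, let I be a set with a transitive Υ-action, let π : Γ → Υ be a surjective group homomorphism, and let K : I → Subgroup(Γ) be a family of subgroups such that the kernel of π equals the subgroup of Γ generated by ⋃_{i∈I} K_i, and such that for every g ∈ Γ and i ∈ I, g K_i g^{-1} = K_{π(g)·i}. Suppose S ⊆ Γ is a finite set such that π(S) generates Υ, and suppose for some j ∈ I there is a finite set T ⊆ Γ generating K_j. Then the finite set S ∪ T generates Γ; in particular, a wreath-like product of a finitely generated group by a finitely generated group with a transitive action is finitely generated. -/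
/-- Let `π : Γ → Υ` be a surjective homomorphism onto a group acting transitively on a
set `I`, and let `K : I → Subgroup Γ` be a family of subgroups whose union generates
`ker π` and which is permuted by conjugation compatibly with the action
(`g K_i g⁻¹ = K_{π(g)·i}`). If `S` is a finite subset of `Γ` whose image generates `Υ`
and `T` is a finite subset generating `K j` for some `j ∈ I`, then `S ∪ T` generates
`Γ`; in particular a wreath-like product of a finitely generated group by a finitely
generated group with a transitive action is finitely generated. -/
theorem wreathLike_finitely_generated {Γ Υ : Type*} [Group Γ] [Group Υ]
    {I : Type*} [MulAction Υ I] (htrans : MulAction.IsPretransitive Υ I)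
    (π : Γ →* Υ) (hsurj : Function.Surjective π)
    (K : I → Subgroup Γ)
    (hker : π.ker = Subgroup.closure (⋃ i : I, (K i : Set Γ)))
    (hconj : ∀ (g : Γ) (i : I),
      (fun x => g * x * g⁻¹) '' (K i : Set Γ) = (K (π g • i) : Set Γ))
    (S : Finset Γ) (hS : Subgroup.closure (π '' (S : Set Γ)) = ⊤)
    (j : I) (T : Finset Γ) (hT : Subgroup.closure (T : Set Γ) = K j) :
    Subgroup.closure ((S : Set Γ) ∪ (T : Set Γ)) = ⊤ := by
  set H := Subgroup.closure ((S : Set Γ) ∪ (T : Set Γ))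
  have hmap : H.map π = ⊤ := by
    rw [eq_top_iff, ← hS, ← MonoidHom.map_closure]
    exact Subgroup.map_mono (Subgroup.closure_mono Set.subset_union_left)
  have hlift (u : Υ) : ∃ h ∈ H, π h = u := by
    simpa using hmap.ge (Subgroup.mem_top u)
  have hKj : K j ≤ H := hT ▸ Subgroup.closure_mono Set.subset_union_right
  have hK (i : I) : K i ≤ H := by
    obtain ⟨u, rfl⟩ := htrans.exists_smul_eq j i
    obtain ⟨h, hh, rfl⟩ := hlift u
    intro x hx
    rw [← SetLike.mem_coe, ← hconj] at hx
    obtain ⟨y, hy, rfl⟩ := hx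
    exact H.mul_mem (H.mul_mem hh (hKj hy)) (H.inv_mem hh)
  have hkerH : π.ker ≤ H := by
    rw [hker, Subgroup.closure_le]
    exact Set.iUnion_subset hK
  refine eq_top_iff.2 fun g _ => ?_
  obtain ⟨h, hh, hg⟩ := hlift (π g)
  have hmem : h⁻¹ * g ∈ H := hkerH (by simp [MonoidHom.mem_ker, hg])
  exact (H.mul_mem_cancel_left (H.inv_mem hh)).1 hmem
end

section
/- Fix an integer n ≥ 4. For every three distinct indices i, j, k ∈ {2,…,n}, the permutations g_i^{-1} g_j and g_k of the set X_n = {1,…,n} × ℕ commute: (g_i^{-1} g_j) g_k = g_k (g_i^{-1} g_j). -/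
/-- The Houghton generator `g_k` as a function: `g_k(1,y) = (1,y+1)`, `g_k(k,0) = (1,0)`,
`g_k(k,y) = (k,y-1)` for `y ≥ 1`, and `g_k(x,y) = (x,y)` otherwise.  (Points of
`ℕ × ℕ` whose first coordinate lies outside `{1,…,n}` are fixed, so this acts as the
Houghton generator on `X_n = {1,…,n} × ℕ`.) -/
def houghtonFun (k : ℕ) : ℕ × ℕ → ℕ × ℕ := fun p =>
  if p.1 = 1 then (1, p.2 + 1)
  else if p.1 = k then (if p.2 = 0 then (1, 0) else (k, p.2 - 1))
  else p

/-- The inverse of the Houghton generator `g_k`. -/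
def houghtonInv (k : ℕ) : ℕ × ℕ → ℕ × ℕ := fun p =>
  if p.1 = 1 then (if p.2 = 0 then (k, 0) else (1, p.2 - 1))
  else if p.1 = k then (k, p.2 + 1)
  else p

/-- The Houghton generator `g_k` (for `2 ≤ k`) as a permutation. -/
def houghtonGen (k : ℕ) (hk : 2 ≤ k) : Equiv.Perm (ℕ × ℕ) where
  toFun := houghtonFun k
  invFun := houghtonInv k
  left_inv := by
    rintro ⟨x, y⟩
    have h1 : k ≠ 1 := by omega
    by_cases hx1 : x = 1
    · subst hx1
      simp [houghtonFun, houghtonInv]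
    · by_cases hxk : x = k
      · subst hxk
        rcases y with _ | y
        · simp [houghtonFun, houghtonInv, h1]
        · simp [houghtonFun, houghtonInv, h1]
      · simp [houghtonFun, houghtonInv, hx1, hxk]
  right_inv := by
    rintro ⟨x, y⟩
    have h1 : k ≠ 1 := by omega
    by_cases hx1 : x = 1
    · subst hx1
      rcases y with _ | y
      · simp [houghtonFun, houghtonInv, h1]
      · simp [houghtonFun, houghtonInv, h1]
    · by_cases hxk : x = k
      · subst hxk
        simp [houghtonFun, houghtonInv, h1]
      · simp [houghtonFun, houghtonInv, hx1, hxk]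

/-- `g_k` fixes every point off the rays `1` and `k`. -/
theorem houghtonGen_apply_of_ne {k : ℕ} (hk : 2 ≤ k) {p : ℕ × ℕ} (h1 : p.1 ≠ 1)
    (hpk : p.1 ≠ k) : houghtonGen k hk p = p := by
  simp [houghtonGen, houghtonFun, h1, hpk]

/-- All Houghton generators agree on the first ray. -/
theorem houghtonGen_apply_one {k : ℕ} (hk : 2 ≤ k) {p : ℕ × ℕ} (h1 : p.1 = 1) :
    houghtonGen k hk p = (1, p.2 + 1) := by
  simp [houghtonGen, houghtonFun, h1]

/-- `g_i⁻¹ g_j` fixes every point off the rays `i` and `j`, including the first ray. -/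
theorem houghtonGen_inv_mul_apply_of_ne {i j : ℕ} (hi : 2 ≤ i) (hj : 2 ≤ j) {p : ℕ × ℕ}
    (hpi : p.1 ≠ i) (hpj : p.1 ≠ j) :
    ((houghtonGen i hi)⁻¹ * houghtonGen j hj) p = p := by
  rw [Equiv.Perm.mul_apply, Equiv.Perm.inv_eq_iff_eq]
  by_cases h1 : p.1 = 1
  · rw [houghtonGen_apply_one hj h1, houghtonGen_apply_one hi h1]
  · rw [houghtonGen_apply_of_ne hj h1 hpj, houghtonGen_apply_of_ne hi h1 hpi]

/-- For `n ≥ 4` and distinct `i, j, k ∈ {2,…,n}`, the permutations `g_i⁻¹ g_j` and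
`g_k` commute. -/
theorem houghton_commute (n : ℕ) (hn : 4 ≤ n) (i j k : ℕ)
    (hi : 2 ≤ i) (hi' : i ≤ n) (hj : 2 ≤ j) (hj' : j ≤ n) (hk : 2 ≤ k) (hk' : k ≤ n)
    (hij : i ≠ j) (hik : i ≠ k) (hjk : j ≠ k) :
    ((houghtonGen i hi)⁻¹ * houghtonGen j hj) * houghtonGen k hk =
      houghtonGen k hk * ((houghtonGen i hi)⁻¹ * houghtonGen j hj) := by
  refine Equiv.Perm.Disjoint.commute fun p => ?_
  by_cases h : p.1 = i ∨ p.1 = j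
  · exact Or.inr (houghtonGen_apply_of_ne hk (by omega) (by omega))
  · rw [not_or] at h
    exact Or.inl (houghtonGen_inv_mul_apply_of_ne hi hj h.1 h.2)
end
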